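/- arXiv:1003.4224 — 2 statements merged into one kernel-verified Lean document; each statement's English description precedes it below -/
import Mathlib

section
/- Suppose that for every perfect object X of D(R) and every n ∈ ℤ the homology module H_n(X) is a flat R-module. Then for any morphism f : K → X in D(R) between perfect objects such that the induced map H_n(f) : H_n(K) → H_n(X) is zero for every n ∈ ℤ, the morphism f is zero in D(R). -/
open CategoryTheory Limits Pretriangulated Opposite

universe w u

variable (R : Type u) [CommRing R] [HasDerivedCategory.{w} (ModuleCat.{u} R)]

/-- The derived category `D(R)` of the category of `R`-modules. -/
noncomputable abbrev DR := DerivedCategory (ModuleCat.{u} R)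

/-- `R[n]`, the `n`-fold shift of the complex consisting of `R` concentrated in degree `0`. -/
noncomputable def Rsph (n : ℤ) : DR R :=
  ((DerivedCategory.singleFunctor (ModuleCat.{u} R) 0).obj (ModuleCat.of R R))⟦n⟧

/-- The `n`-th homology module `H_n(X)` of an object `X` of `D(R)` (with homological
indexing, so that `H_n = H^{-n}` cohomologically and `H_n(R[n]) = R`). -/
noncomputable def Hmod (n : ℤ) : DR R ⥤ ModuleCat.{u} R :=
  DerivedCategory.homologyFunctor (ModuleCat.{u} R) (-n)

/-- A class of objects in `D(R)` is *thick-closed* if it is closed under isomorphisms,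
shifts, retracts, and completion of distinguished triangles (two-out-of-three). -/
def IsThickClosed (P : Set (DR R)) : Prop :=
  (∀ X Y : DR R, (X ≅ Y) → X ∈ P → Y ∈ P) ∧
  (∀ (X : DR R) (n : ℤ), X ∈ P → X⟦n⟧ ∈ P) ∧
  (∀ (X Y : DR R) (i : X ⟶ Y) (r : Y ⟶ X), i ≫ r = 𝟙 X → Y ∈ P → X ∈ P) ∧
  (∀ Tr : Triangle (DR R), Tr ∈ (distTriang (DR R)) →
    ((Tr.obj₁ ∈ P → Tr.obj₂ ∈ P → Tr.obj₃ ∈ P) ∧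
     (Tr.obj₂ ∈ P → Tr.obj₃ ∈ P → Tr.obj₁ ∈ P) ∧
     (Tr.obj₁ ∈ P → Tr.obj₃ ∈ P → Tr.obj₂ ∈ P)))

/-- An object of `D(R)` is *perfect* if it lies in the thick subcategory generated by `R`,
i.e. if it belongs to every thick-closed class of objects containing `R[n]` for all `n`. -/
def IsPerfect (X : DR R) : Prop :=
  ∀ P : Set (DR R), (∀ n : ℤ, Rsph R n ∈ P) → IsThickClosed R P → X ∈ P


section
universe v' u' w'
variable {A : Type u'} [Category.{v'} A] [Abelian A]

lemma zcx_null (Z : CochainComplex A ℤ) (hd : ∀ i j, Z.d i j = 0)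
    [∀ n, Projective (Z.X n)] (L : CochainComplex A ℤ) (g : Z ⟶ L)
    (h : ∀ n, HomologicalComplex.homologyMap g n = 0) : Nonempty (Homotopy g 0) := by
  have key : ∀ i j : ℤ, j + 1 = i → ∃ σ : Z.X i ⟶ L.X j, σ ≫ L.d j i = g.f i := by
    intro i j hij
    have hn : (ComplexShape.up ℤ).next i = i + 1 := by simp
    have hp : (ComplexShape.up ℤ).prev i = j := by simp; omega
    have hex : (ShortComplex.mk (L.toCycles j i) (L.homologyπ i) (by simp)).Exact :=
      ShortComplex.exact_of_g_is_cokernel _ (L.homologyIsCokernel j i hp)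
    let a : Z.X i ⟶ Z.cycles i := Z.liftCycles (𝟙 (Z.X i)) (i+1) hn (by rw [hd]; simp)
    have ha : a ≫ HomologicalComplex.cyclesMap g i ≫ L.homologyπ i = 0 := by
      rw [← HomologicalComplex.homologyπ_naturality, h]; simp
    refine ⟨hex.liftFromProjective (a ≫ HomologicalComplex.cyclesMap g i) (by simpa using ha), ?_⟩
    have := hex.liftFromProjective_comp (a ≫ HomologicalComplex.cyclesMap g i) (by simpa using ha)
    have h2 := congrArg (· ≫ L.iCycles i) this
    simpa [a] using h2
  choose σ hσ using key
  refine ⟨⟨fun i j => if hij : j + 1 = i then σ i j hij else 0, ?_, ?_⟩⟩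
  · intro i j hij
    simp at hij
    simp [hij]
  · intro i
    rw [dNext_eq _ (show (ComplexShape.up ℤ).Rel i (i+1) by simp), prevD_eq _ (show (ComplexShape.up ℤ).Rel (i-1) i by simp)]
    simp [hσ, hd]

lemma zcx_kproj (Z : CochainComplex A ℤ) (hd : ∀ i j, Z.d i j = 0)
    [∀ n, Projective (Z.X n)] : Z.IsKProjective where
  nonempty_homotopy_zero {L} f hL := zcx_null Z hd L f fun n => (hL n).isZero_homology.eq_of_tgt _ _

lemma zcx_exists (M : ℤ → A) : ∃ Z : CochainComplex A ℤ, (∀ i j, Z.d i j = 0) ∧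
    Nonempty (∀ n, Z.X n ≅ M n) :=
  ⟨{ X := M, d := fun _ _ => 0 }, fun _ _ => rfl, ⟨fun _ => Iso.refl _⟩⟩

lemma zcx_formal (L : CochainComplex A ℤ) [∀ n, Projective (L.homology n)] :
    ∃ (Z : CochainComplex A ℤ) (_ : ∀ i j, Z.d i j = 0) (_ : ∀ n, Projective (Z.X n))
      (φ : Z ⟶ L), QuasiIso φ := by
  let s : ∀ n, L.homology n ⟶ L.cycles n := fun n => Projective.factorThru (𝟙 _) (L.homologyπ n)
  have hs : ∀ n, s n ≫ L.homologyπ n = 𝟙 _ := fun n => Projective.factorThru_comp _ _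
  obtain ⟨Z, hd, ⟨e⟩⟩ := zcx_exists (fun n => L.homology n)
  let φ : Z ⟶ L := 
    { f := fun n => (e n).hom ≫ s n ≫ L.iCycles n
      comm' := by intro i j _; simp [hd] }
  refine ⟨Z, hd, fun n => Projective.of_iso (e n).symm inferInstance, φ, ⟨fun n => ?_⟩⟩
  rw [quasiIsoAt_iff_isIso_homologyMap]
  have : IsIso (Z.iCycles n) := Z.isIso_iCycles n (n+1) (by simp) (hd _ _)
  have : IsIso (Z.homologyπ n) := Z.isIso_homologyπ (n-1) n (by simp) (hd _ _)
  have h1 : HomologicalComplex.cyclesMap φ n = Z.iCycles n ≫ (e n).hom ≫ s n := by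
    rw [← cancel_mono (L.iCycles n)]
    simp [φ]
  have h2 : Z.homologyπ n ≫ HomologicalComplex.homologyMap φ n = Z.iCycles n ≫ (e n).hom := by
    rw [HomologicalComplex.homologyπ_naturality, h1, Category.assoc, Category.assoc, hs]
    simp
  have : HomologicalComplex.homologyMap φ n = inv (Z.homologyπ n) ≫ Z.iCycles n ≫ (e n).hom := by
    rw [← h2, IsIso.inv_hom_id_assoc]
  rw [this]
  infer_instance

lemma eq_zero_of_proj_homology [HasDerivedCategory.{w'} A] (K X : DerivedCategory A)
    (hK : ∀ n, Projective ((DerivedCategory.homologyFunctor A n).obj K)) (f : K ⟶ X)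
    (hf : ∀ n, (DerivedCategory.homologyFunctor A n).map f = 0) : f = 0 := by
  obtain ⟨L, ⟨eL⟩⟩ : ∃ L, Nonempty (DerivedCategory.Q.obj L ≅ K) := ⟨_, ⟨DerivedCategory.Q.objObjPreimageIso K⟩⟩
  obtain ⟨Y, ⟨eY⟩⟩ : ∃ L, Nonempty (DerivedCategory.Q.obj L ≅ X) := ⟨_, ⟨DerivedCategory.Q.objObjPreimageIso X⟩⟩
  have : ∀ n, Projective (L.homology n) := fun n => 
    Projective.of_iso ((DerivedCategory.homologyFunctor A n).mapIso eL.symm ≪≫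
      (DerivedCategory.homologyFunctorFactors A n).app L) (hK n)
  obtain ⟨Z, hd, hP, φ, hφ⟩ := zcx_formal L
  have := zcx_kproj Z hd
  obtain ⟨g, hg⟩ := (CochainComplex.IsKProjective.Qh_map_bijective Z
    ((HomotopyCategory.quotient _ _).obj Y)).surjective
    ((DerivedCategory.quotientCompQhIso A).hom.app _ ≫ DerivedCategory.Q.map φ ≫ eL.hom ≫ f ≫ eY.inv ≫ (DerivedCategory.quotientCompQhIso A).inv.app Y)
  obtain ⟨g, rfl⟩ := (HomotopyCategory.quotient _ _).map_surjective g
  have hg' : DerivedCategory.Q.map g = DerivedCategory.Q.map φ ≫ eL.hom ≫ f ≫ eY.inv := by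
    rw [← cancel_epi ((DerivedCategory.quotientCompQhIso A).hom.app _), 
      ← DerivedCategory.quotientCompQhIso_hom_naturality, hg]
    simp
  obtain ⟨H⟩ := zcx_null Z hd _ g (by
    intro n
    have h1 := DerivedCategory.homologyFunctorFactors_hom_naturality g n
    rw [hg'] at h1
    simp only [Functor.map_comp, hf, zero_comp, comp_zero] at h1
    exact (cancel_epi ((DerivedCategory.homologyFunctorFactors A n).hom.app Z)).1
      (h1.symm.trans comp_zero.symm))
  have h0 := DerivedCategory.Q_map_eq_of_homotopy A H
  rw [hg'] at h0
  simpa using h0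
end

section FP
variable {R}

lemma fp_five (hfp : ∀ (M : Type u) [AddCommGroup M] [Module R M],
      Module.FinitePresentation R M → Module.Projective R M)
    {A B C D E : Type u} [AddCommGroup A] [Module R A] [AddCommGroup B] [Module R B]
    [AddCommGroup C] [Module R C] [AddCommGroup D] [Module R D] [AddCommGroup E] [Module R E]
    (f : A →ₗ[R] B) (g : B →ₗ[R] C) (h : C →ₗ[R] D) (k : D →ₗ[R] E)
    (hfg : Function.Exact f g) (hgh : Function.Exact g h) (hhk : Function.Exact h k)
    (hA : Module.FinitePresentation R A) (hB : Module.FinitePresentation R B)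
    (hD : Module.FinitePresentation R D) (hE : Module.FinitePresentation R E) :
    Module.FinitePresentation R C := by
  have coker : ∀ {A B : Type u} [AddCommGroup A] [Module R A] [AddCommGroup B] [Module R B]
      (f : A →ₗ[R] B), Module.FinitePresentation R A → Module.FinitePresentation R B → 
      Module.FinitePresentation R (B ⧸ LinearMap.range f) := by
    intro A B _ _ _ _ f hA hB
    refine Module.finitePresentation_of_surjective (LinearMap.range f).mkQ
      (Submodule.mkQ_surjective _) ?_
    rw [Submodule.ker_mkQ]
    exact Submodule.fg_range _
  have h1 := coker f hA hB
  have h2 := coker k hD hE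
  have := hfp _ h2
  have h3 : Module.FinitePresentation R (LinearMap.range k) :=
    Module.finitePresentation_of_projective_of_exact (LinearMap.range k).subtype
      (LinearMap.range k).mkQ (Submodule.injective_subtype _) (Submodule.mkQ_surjective _)
      (by rw [LinearMap.exact_iff]; simp)
  have := hfp _ h3
  have h4 : Module.FinitePresentation R (LinearMap.ker k) :=
    Module.finitePresentation_of_projective_of_exact (LinearMap.ker k).subtype
      k.rangeRestrict (Submodule.injective_subtype _) k.surjective_rangeRestrict
      (by rw [LinearMap.exact_iff]; simp)
  rw [LinearMap.exact_iff] at hfg hgh hhk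
  have h5 : Module.FinitePresentation R (LinearMap.range h) := by
    rw [← hhk]; exact h4
  rw [← hfg] at h1
  have h6 := Module.FinitePresentation.of_equiv g.quotKerEquivRange
  have h7 : Module.FinitePresentation R (LinearMap.ker h.rangeRestrict) := by
    rw [LinearMap.ker_rangeRestrict, hgh]; exact h6
  exact Module.finitePresentation_of_ker h.rangeRestrict h.surjective_rangeRestrict

lemma fp_iso {M N : ModuleCat.{u} R} (e : M ≅ N) (h : Module.FinitePresentation R M) :
    Module.FinitePresentation R N :=
  Module.FinitePresentation.of_equiv e.toLinearEquiv

end FP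

lemma exact_transport {A : Type*} [Category A] [Abelian A] {X₁ X₂ X₃ Y₁ Y₂ : A}
    (a : X₁ ⟶ X₂) (b : X₂ ⟶ X₃) (w : a ≫ b = 0) (h : (ShortComplex.mk a b w).Exact)
    (e₁ : X₁ ≅ Y₁) (e₂ : X₂ ≅ Y₂) (c : Y₁ ⟶ Y₂) (hc : a ≫ e₂.hom = e₁.hom ≫ c) :
    ∃ w', (ShortComplex.mk c (e₂.inv ≫ b) w').Exact := by
  have w' : c ≫ e₂.inv ≫ b = 0 := by
    rw [← cancel_epi e₁.hom, ← reassoc_of% hc]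
    simp [w]
  let i : ShortComplex.mk a b w ≅ ShortComplex.mk c (e₂.inv ≫ b) w' :=
    ShortComplex.isoMk e₁ e₂ (Iso.refl _) hc.symm (by simp)
  exact ⟨w', ShortComplex.exact_of_iso i h⟩

lemma perf_thick : IsThickClosed R {X | IsPerfect R X} := by
  refine ⟨fun X Y e h P h1 h2 => h2.1 X Y e (h P h1 h2),
    fun X n h P h1 h2 => h2.2.1 X n (h P h1 h2),
    fun X Y i r e h P h1 h2 => h2.2.2.1 X Y i r e (h P h1 h2), fun T hT => ⟨?_, ?_, ?_⟩⟩
  · exact fun h h' P h1 h2 => (h2.2.2.2 T hT).1 (h P h1 h2) (h' P h1 h2)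
  · exact fun h h' P h1 h2 => (h2.2.2.2 T hT).2.1 (h P h1 h2) (h' P h1 h2)
  · exact fun h h' P h1 h2 => (h2.2.2.2 T hT).2.2 (h P h1 h2) (h' P h1 h2)

lemma perf_sph (n : ℤ) : IsPerfect R (Rsph R n) := fun _ h _ => h n

lemma perf_free (n : ℕ) : IsPerfect R
    ((DerivedCategory.singleFunctor (ModuleCat.{u} R) 0).obj (ModuleCat.of R (Fin n → R))) := by
  induction n with
  | zero =>
    refine (perf_thick R).2.2.1 _ (Rsph R 0) 0 0 ?_ (perf_sph R 0)
    have : IsZero (ModuleCat.of R (Fin 0 → R)) := ModuleCat.isZero_of_subsingleton _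
    have h := (DerivedCategory.singleFunctor (ModuleCat.{u} R) 0).map_isZero this
    exact h.eq_of_src _ _
  | succ n ih =>
    let S : ShortComplex (ModuleCat.{u} R) := ShortComplex.mk (X₁ := ModuleCat.of R R)
      (X₂ := ModuleCat.of R (Fin (n+1) → R)) (X₃ := ModuleCat.of R (Fin n → R))
      (ModuleCat.ofHom (LinearMap.single R (fun _ => R) 0))
      (ModuleCat.ofHom (LinearMap.funLeft R R Fin.succ)) (by
        ext x
        rfl)
    have hS : S.ShortExact := ModuleCat.shortComplex_shortExact S (by
        intro x
        constructor
        · intro hx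
          refine ⟨x 0, ?_⟩
          funext i
          refine Fin.cases ?_ (fun i => ?_) i
          · simp [S]
          · have := congrFun hx i
            exact this.symm
        · rintro ⟨y, rfl⟩
          exact S.zero_apply y)
      (by
        intro a b hab
        have := congrFun hab (0 : Fin (n+1))
        simpa [S] using this)
      (LinearMap.funLeft_surjective_of_injective R R _ (Fin.succ_injective n))
    refine ((perf_thick R).2.2.2 _ hS.singleTriangle_distinguished).2.2 ?_ ih
    exact (perf_thick R).1 _ _ ((shiftFunctorZero (DR R) ℤ).app _) (perf_sph R 0)

open DerivedCategory in
lemma fp_proj (hflat : ∀ X : DR R, IsPerfect R X → ∀ n : ℤ, Module.Flat R ((Hmod R n).obj X))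
    (M : Type u) [AddCommGroup M] [Module R M] (hM : Module.FinitePresentation R M) :
    Module.Projective R M := by
  suffices Module.Flat R M from Module.Flat.projective_of_finitePresentation
  obtain ⟨n, m, f, g, hf, hgf⟩ := Module.FinitePresentation.exists_fin' R M
  let F := singleFunctor (ModuleCat.{u} R) 0
  obtain ⟨C, p, q, hT⟩ := distinguished_cocone_triangle (F.map (ModuleCat.ofHom g))
  have hC : IsPerfect R C := ((perf_thick R).2.2.2 _ hT).1 (perf_free R m) (perf_free R n)
  have hfl : Module.Flat R ((homologyFunctor (ModuleCat.{u} R) 0).obj C) := hflat C hC 0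
  have ex := HomologySequence.exact₂ _ hT 0
  have hd : HomologySequence.δ (Triangle.mk (F.map (ModuleCat.ofHom g)) p q) 0 1 = 0 :=
    (isZero_of_isLE (F.obj (ModuleCat.of R (Fin m → R))) 0 1 (by simp)).eq_of_tgt _ _
  have ep := (HomologySequence.epi_homologyMap_mor₂_iff _ hT 0 1).2 hd
  have ep' : Epi ((homologyFunctor (ModuleCat.{u} R) 0).map p) := ep
  have hz : (homologyFunctor (ModuleCat.{u} R) 0).map (F.map (ModuleCat.ofHom g)) ≫
      (homologyFunctor (ModuleCat.{u} R) 0).map p = 0 := by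
    rw [← Functor.map_comp]
    exact (congrArg _ (comp_distTriang_mor_zero₁₂ _ hT)).trans (Functor.map_zero _ _ _)
  let e := singleFunctorCompHomologyFunctorIso (ModuleCat.{u} R) 0
  obtain ⟨hw, ex2⟩ := exact_transport _ _ hz ex (e.app (ModuleCat.of R (Fin m → R)))
    (e.app (ModuleCat.of R (Fin n → R))) (ModuleCat.ofHom g) (e.hom.naturality (ModuleCat.ofHom g))
  have ep2 : Epi ((e.app (ModuleCat.of R (Fin n → R))).inv ≫ (homologyFunctor (ModuleCat.{u} R) 0).map p) := epi_comp _ _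
  have hk := ex2.moduleCat_range_eq_ker
  rw [ModuleCat.epi_iff_surjective] at ep2
  rw [LinearMap.exact_iff] at hgf
  exact Module.Flat.of_linearEquiv ((f.quotKerEquivOfSurjective hf).symm ≪≫ₗ
    Submodule.quotEquivOfEq _ _ (hgf.trans hk) ≪≫ₗ LinearMap.quotKerEquivOfSurjective _ ep2)

open DerivedCategory in
lemma fp_thick (hfp : ∀ (M : Type u) [AddCommGroup M] [Module R M],
      Module.FinitePresentation R M → Module.Projective R M) :
    IsThickClosed R {X | ∀ n, Module.FinitePresentation R ((homologyFunctor (ModuleCat.{u} R) n).obj X)} := by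
  have hiso : ∀ X Y : DR R, (X ≅ Y) → 
      (∀ n, Module.FinitePresentation R ((homologyFunctor (ModuleCat.{u} R) n).obj X)) → 
      (∀ n, Module.FinitePresentation R ((homologyFunctor (ModuleCat.{u} R) n).obj Y)) := by
    intro X Y e h n
    exact fp_iso ((homologyFunctor (ModuleCat.{u} R) n).mapIso e) (h n)
  have hsh : ∀ (X : DR R) (m : ℤ),  
      (∀ n, Module.FinitePresentation R ((homologyFunctor (ModuleCat.{u} R) n).obj X)) → 
      (∀ n, Module.FinitePresentation R ((homologyFunctor (ModuleCat.{u} R) n).obj (X⟦m⟧))) := by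
    intro X m h n
    exact fp_iso (((homologyFunctor (ModuleCat.{u} R) 0).shiftIso m n (m+n) rfl).app X).symm (h (m + n))
  have h3 : ∀ T : Triangle (DR R), T ∈ distTriang (DR R) → 
      (∀ n, Module.FinitePresentation R ((homologyFunctor (ModuleCat.{u} R) n).obj T.obj₁)) → 
      (∀ n, Module.FinitePresentation R ((homologyFunctor (ModuleCat.{u} R) n).obj T.obj₂)) →
      (∀ n, Module.FinitePresentation R ((homologyFunctor (ModuleCat.{u} R) n).obj T.obj₃)) := by
    intro T hT h1 h2 n
    have e1 := (ShortComplex.ShortExact.moduleCat_exact_iff_function_exact _).1 (HomologySequence.exact₂ T hT n)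
    have e2 := (ShortComplex.ShortExact.moduleCat_exact_iff_function_exact _).1 (HomologySequence.exact₃ T hT n (n+1))
    have e3 := (ShortComplex.ShortExact.moduleCat_exact_iff_function_exact _).1 (HomologySequence.exact₁ T hT n (n+1))
    exact fp_five hfp _ _ _ _ e1 e2 e3 (h1 n) (h2 n) (h1 (n+1)) (h2 (n+1))
  refine ⟨hiso, hsh, ?_, fun T hT => ⟨h3 T hT, fun a b => ?_, fun a b => ?_⟩⟩
  · intro X Y i r hir h n
    have := h n
    have := hfp _ this
    let H := homologyFunctor (ModuleCat.{u} R) n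
    have hir' : H.map i ≫ H.map r = 𝟙 _ := by rw [← H.map_comp, hir, H.map_id]
    have hc : (H.map r).hom ∘ₗ (H.map i).hom = LinearMap.id := by
      rw [← ModuleCat.hom_comp, hir']; rfl
    have hs : Function.Surjective (H.map r).hom :=
      Function.LeftInverse.surjective (DFunLike.congr_fun hc)
    have := Module.Projective.of_split _ _ hc
    have := Module.Finite.of_surjective _ hs
    exact Module.finitePresentation_of_projective _ _
  · have := h3 _ (rot_of_distTriang _ hT) a b
    exact hiso _ _ ((shiftFunctorCompIsoId (DR R) (1:ℤ) (-1) (by simp)).app T.obj₁) (hsh _ (-1) this)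
  · exact h3 _ (inv_rot_of_distTriang _ hT) (hsh _ _ b) a

open DerivedCategory in
lemma fp_sph (n k : ℤ) : Module.FinitePresentation R ((homologyFunctor (ModuleCat.{u} R) k).obj (Rsph R n)) := by
  let F := singleFunctor (ModuleCat.{u} R) 0
  have e := (((homologyFunctor (ModuleCat.{u} R) 0).shiftIso n k (n+k) rfl).app (F.obj (ModuleCat.of R R))).symm
  suffices Module.FinitePresentation R ((homologyFunctor (ModuleCat.{u} R) (n+k)).obj (F.obj (ModuleCat.of R R))) from
    fp_iso e this
  generalize n + k = j
  have zero : IsZero ((homologyFunctor (ModuleCat.{u} R) j).obj (F.obj (ModuleCat.of R R))) → 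
      Module.FinitePresentation R ((homologyFunctor (ModuleCat.{u} R) j).obj (F.obj (ModuleCat.of R R))) := by
    intro h
    have := ModuleCat.subsingleton_of_isZero h
    exact Module.finitePresentation_of_projective _ _
  rcases lt_trichotomy j 0 with h | rfl | h
  · exact zero (isZero_of_isGE _ 0 j h)
  · have : Module.FinitePresentation R (ModuleCat.of R R) := inferInstanceAs (Module.FinitePresentation R R)
    exact fp_iso
      ((singleFunctorCompHomologyFunctorIso (ModuleCat.{u} R) 0).app (ModuleCat.of R R)).symm this
  · exact zero (isZero_of_isLE _ 0 j h)

/-- if the homology modules of every perfect object of `D(R)` are flat, then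
any morphism between perfect objects of `D(R)` inducing zero on all homology modules is
zero in `D(R)`. -/
theorem freyd_derivedCategory_of_flat_homology
    (hflat : ∀ X : DR R, IsPerfect R X → ∀ n : ℤ, Module.Flat R ((Hmod R n).obj X))
    (K X : DR R) (hK : IsPerfect R K) (hX : IsPerfect R X)
    (f : K ⟶ X) (hf : ∀ n : ℤ, (Hmod R n).map f = 0) :
    f = 0 := by
  have hfp := fun (M : Type u) [AddCommGroup M] [Module R M] => fp_proj R hflat M
  have hP := hK _ (fun n => show Rsph R n ∈ {X | ∀ k, Module.FinitePresentation R
      ((DerivedCategory.homologyFunctor (ModuleCat.{u} R) k).obj X)} from fun k => fp_sph R n k) (fp_thick R hfp)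
  refine eq_zero_of_proj_homology K X (fun n => ?_) f (fun n => ?_)
  · have := hfp _ (hP n)
    infer_instance
  · obtain ⟨m, rfl⟩ : ∃ m, n = -m := ⟨-n, by simp⟩
    exact hf m
end

section
/- Let 0 → M → L → N → 0 be a short exact sequence of R-modules in which L is flat and M is FP-injective. Then N is a flat R-module. -/
open CategoryTheory Limits

universe w' u

variable (R : Type u) [CommRing R]

/-- An `R`-module `M` is *FP-injective* if `Ext¹_R(F, M) = 0` for every finitely
presented `R`-module `F`. -/
def FPInjective [HasExt.{w'} (ModuleCat.{u} R)] (M : Type u) [AddCommGroup M]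
    [Module R M] : Prop :=
  ∀ (F : Type u) [AddCommGroup F] [Module R F], Module.FinitePresentation R F →
    Subsingleton (Abelian.Ext (ModuleCat.of R F) (ModuleCat.of R M) 1)

/-- given a short exact sequence `0 → M → L → N → 0` of `R`-modules with
`L` flat and `M` FP-injective, the quotient `N` is flat. -/
theorem flat_of_shortExact_of_fpInjective
    [HasExt.{w'} (ModuleCat.{u} R)]
    (M L N : Type u) [AddCommGroup M] [Module R M] [AddCommGroup L] [Module R L]
    [AddCommGroup N] [Module R N]
    (f : M →ₗ[R] L) (g : L →ₗ[R] N)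
    (hf : Function.Injective f) (hg : Function.Surjective g)
    (hfg : Function.Exact f g)
    (hM : FPInjective R M) (hL : Module.Flat R L) :
    Module.Flat R N := by
  have lift : ∀ (F : Type u) [AddCommGroup F] [Module R F], Module.FinitePresentation R F →
      ∀ x : F →ₗ[R] N, ∃ y : F →ₗ[R] L, g ∘ₗ y = x := by
    intro F _ _ hF x
    have := hM F hF
    let S : ShortComplex (ModuleCat.{u} R) :=
      ShortComplex.mk (ModuleCat.ofHom f) (ModuleCat.ofHom g) (by
        rw [← ModuleCat.ofHom_comp, hfg.linearMap_comp_eq_zero]; rfl)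
    have hS : S.ShortExact :=
      { exact := (ShortComplex.ShortExact.moduleCat_exact_iff_function_exact S).mpr hfg
        mono_f := (ModuleCat.mono_iff_injective _).mpr hf
        epi_g := (ModuleCat.epi_iff_surjective _).mpr hg }
    obtain ⟨y, hy⟩ := Abelian.Ext.covariant_sequence_exact₃ (ModuleCat.of R F) hS
      (Abelian.Ext.mk₀ (ModuleCat.ofHom x : ModuleCat.of R F ⟶ S.X₃)) (zero_add 1)
      (this.elim _ _)
    obtain ⟨y, rfl⟩ := (Abelian.Ext.mk₀_bijective _ _).2 y
    rw [Abelian.Ext.mk₀_comp_mk₀] at hy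
    have h2 := (Abelian.Ext.mk₀_bijective _ _).1 hy
    exact ⟨y.hom, congrArg ModuleCat.Hom.hom h2⟩
  apply Module.Flat.of_forall_exists_factorization
  intro l v x hx
  let K : Submodule R (Fin l →₀ R) := Submodule.span R {v}
  have hK : K ≤ LinearMap.ker x := by
    rw [Submodule.span_singleton_le_iff_mem]; exact hx
  have hfp : Module.FinitePresentation R ((Fin l →₀ R) ⧸ K) :=
    Module.finitePresentation_of_surjective K.mkQ K.mkQ_surjective (by
      rw [Submodule.ker_mkQ]; exact Submodule.fg_span_singleton v)
  obtain ⟨y, hy⟩ := lift _ hfp (K.liftQ x hK)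
  obtain ⟨k, a, b, hab⟩ := Module.Flat.exists_factorization_of_finitePresentation y
  refine ⟨k, a ∘ₗ K.mkQ, g ∘ₗ b, ?_, ?_⟩
  · rw [LinearMap.comp_assoc, ← LinearMap.comp_assoc K.mkQ, ← hab, ← LinearMap.comp_assoc, hy,
      Submodule.liftQ_mkQ]
  · have : K.mkQ v = 0 := by
      rw [Submodule.mkQ_apply, Submodule.Quotient.mk_eq_zero]
      exact Submodule.mem_span_singleton_self v
    rw [LinearMap.comp_apply, this, map_zero]
end
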